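/- arXiv:1707.05008 — 2 statements merged into one kernel-verified Lean document; each statement's English description precedes it below -/
import Mathlib

section
/- For every integer n ≥ 1 and every primitive n-th root of unity ζ_n ∈ ℂ, the identity 2·z_n^⋆(4,1;ζ_n) + z_n^⋆(3,2;ζ_n) = ((n⁴−1)(n+5)/1440)·(1−ζ_n)⁵ + ((n+2)/3)·(1−ζ_n)²·z_n^⋆(2,1;ζ_n) holds. -/
/-- The `q`-integer `[m]_q = (1 - q^m)/(1 - q)`. -/
noncomputable def qint (q : ℂ) (m : ℕ) : ℂ := (1 - q ^ m) / (1 - q)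

/-- The star finite multiple harmonic `q`-series
`z_n^⋆(k_1,…,k_r; q) = ∑_{n > m_1 ≥ ⋯ ≥ m_r > 0} ∏_j q^{(k_j-1)m_j}/[m_j]_q^{k_j}`. -/
noncomputable def zqStar (q : ℂ) : List ℕ → ℕ → ℂ
  | [], _ => 1
  | k :: ks, n => ∑ m ∈ Finset.Ioo 0 n, q ^ ((k - 1) * m) / qint q m ^ k * zqStar q ks (m + 1)

open Finset

lemma sum_range_id_mul_pow (x : ℂ) (N : ℕ) :
    (∑ j ∈ range N, (j : ℂ) * x ^ j) * (1 - x) ^ 2 =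
      x - N * x ^ N + (N - 1) * x ^ (N + 1) := by
  induction N with
  | zero => simp
  | succ N ih => rw [sum_range_succ, add_mul, ih]; push_cast; ring

lemma sum_range_sq_mul_pow (x : ℂ) (N : ℕ) :
    (∑ j ∈ range N, (j : ℂ) ^ 2 * x ^ j) * (1 - x) ^ 3 =
      x + x ^ 2 - N ^ 2 * x ^ N + (2 * N ^ 2 - 2 * N - 1) * x ^ (N + 1)
        - (N - 1) ^ 2 * x ^ (N + 2) := by
  induction N with
  | zero => simp
  | succ N ih => rw [sum_range_succ, add_mul, ih]; push_cast; ring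

lemma sum_range_sq_mul_sub_sq (x : ℂ) (N : ℕ) :
    ∑ j ∈ range N, ((j : ℂ) * (x - j)) ^ 2 =
      N * (N - 1) * (2 * N - 1) / 6 * x ^ 2 - (N * (N - 1)) ^ 2 / 2 * x
        + N * (N - 1) * (2 * N - 1) * (3 * N ^ 2 - 3 * N - 1) / 30 := by
  induction N with
  | zero => simp
  | succ N ih => rw [sum_range_succ, ih]; push_cast; ring

lemma sum_Ioo_zero_eq_sum_range {f : ℕ → ℂ} (hf : f 0 = 0) (n : ℕ) :
    ∑ j ∈ Ioo 0 n, f j = ∑ j ∈ range n, f j := by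
  refine sum_subset (fun j hj => ?_) (fun j hj hj' => ?_)
  · simp at hj ⊢; omega
  · have : j = 0 := by simp at hj hj'; omega
    rw [this, hf]

/-- The discrete Fourier transform of `m ↦ 1 / (1 - ζ ^ m) ^ s` on `0 < m < n`. -/
noncomputable def geomInvDFT (ζ : ℂ) (n s j : ℕ) : ℂ :=
  ∑ m ∈ Ioo 0 n, ((1 - ζ ^ m)⁻¹) ^ s * ζ ^ (j * m)

section

variable {ζ : ℂ} {n : ℕ}

lemma one_sub_pow_ne_zero (hζ : IsPrimitiveRoot ζ n) {m : ℕ} (hm : m ∈ Ioo 0 n) :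
    1 - ζ ^ m ≠ 0 := by
  rw [mem_Ioo] at hm
  exact sub_ne_zero.2 (hζ.pow_ne_one_of_pos_of_lt hm.1.ne' hm.2).symm

lemma pow_pow_eq_one (hζ : IsPrimitiveRoot ζ n) (m : ℕ) : (ζ ^ m) ^ n = 1 := by
  rw [← pow_mul, mul_comm, pow_mul, hζ.pow_eq_one, one_pow]

lemma inv_one_sub_pow_eq_sum (hn : n ≠ 0) (hζ : IsPrimitiveRoot ζ n) {m : ℕ}
    (hm : m ∈ Ioo 0 n) :
    (1 - ζ ^ m)⁻¹ = ∑ j ∈ Ioo 0 n, (-(j : ℂ) / n) * ζ ^ (j * m) := by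
  have h0 := one_sub_pow_ne_zero hζ hm
  have h1 := sum_range_id_mul_pow (ζ ^ m) n
  simp only [pow_add, pow_pow_eq_one hζ m] at h1
  have hn' : (n : ℂ) ≠ 0 := by exact_mod_cast hn
  rw [sum_Ioo_zero_eq_sum_range (by simp)]
  have h2 : ∑ j ∈ range n, (-(j : ℂ) / n) * ζ ^ (j * m) =
      -(∑ j ∈ range n, (j : ℂ) * (ζ ^ m) ^ j) / n := by
    rw [← sum_neg_distrib, sum_div]
    refine sum_congr rfl fun j _ => ?_
    rw [mul_comm j m, pow_mul]; ring
  rw [h2]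
  generalize ∑ j ∈ range n, (j : ℂ) * (ζ ^ m) ^ j = S at *
  field_simp
  apply mul_right_cancel₀ h0
  linear_combination h1

lemma inv_one_sub_pow_sq_sub_eq_sum (hn : n ≠ 0) (hζ : IsPrimitiveRoot ζ n) {m : ℕ}
    (hm : m ∈ Ioo 0 n) :
    ((1 - ζ ^ m)⁻¹) ^ 2 - (1 - ζ ^ m)⁻¹ =
      ∑ j ∈ Ioo 0 n, ((j : ℂ) * (n - j) / (2 * n)) * ζ ^ (j * m) := by
  have h0 := one_sub_pow_ne_zero hζ hm
  have h1 := sum_range_id_mul_pow (ζ ^ m) n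
  have h2 := sum_range_sq_mul_pow (ζ ^ m) n
  simp only [pow_add, pow_pow_eq_one hζ m] at h1 h2
  have hn' : (n : ℂ) ≠ 0 := by exact_mod_cast hn
  rw [sum_Ioo_zero_eq_sum_range (by simp)]
  have h3 : ∑ j ∈ range n, ((j : ℂ) * (n - j) / (2 * n)) * ζ ^ (j * m) =
      (n * (∑ j ∈ range n, (j : ℂ) * (ζ ^ m) ^ j) -
        ∑ j ∈ range n, (j : ℂ) ^ 2 * (ζ ^ m) ^ j) / (2 * n) := by
    rw [mul_sum, ← sum_sub_distrib, sum_div]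
    refine sum_congr rfl fun j _ => ?_
    rw [mul_comm j m, pow_mul]; ring
  rw [h3]
  generalize ∑ j ∈ range n, (j : ℂ) * (ζ ^ m) ^ j = S at *
  generalize ∑ j ∈ range n, (j : ℂ) ^ 2 * (ζ ^ m) ^ j = T at *
  field_simp
  apply mul_right_cancel₀ h0
  linear_combination h2 - n * (1 - ζ ^ m) * h1

lemma sum_Ioo_pow_mul (hζ : IsPrimitiveRoot ζ n) {j : ℕ} (hj : j ∈ Ioo 0 n) (m : ℕ) :
    ∑ k ∈ Ioo 0 (m + 1), ζ ^ (j * k) =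
      ((1 - ζ ^ j)⁻¹ - 1) * (1 - ζ ^ (j * m)) := by
  have h0 := one_sub_pow_ne_zero hζ hj
  induction m with
  | zero => rw [zero_add, mul_zero, pow_zero, sub_self, mul_zero]; rfl
  | succ m ih =>
    have : Ioo 0 (m + 1 + 1) = insert (m + 1) (Ioo 0 (m + 1)) := by
      ext; simp only [mem_Ioo, mem_insert]; omega
    rw [this, sum_insert (by simp), ih, mul_add j m 1, pow_add, mul_one]
    field_simp
    ring

/-- Summation of a double star sum whose inner summand is given by its Fourier expansion. -/
lemma sum_mul_sum_eq_of_fourier (hζ : IsPrimitiveRoot ζ n) (F g c : ℕ → ℂ)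
    (hg : ∀ k ∈ Ioo 0 n, g k = ∑ j ∈ Ioo 0 n, c j * ζ ^ (j * k)) :
    ∑ m ∈ Ioo 0 n, F m * ∑ k ∈ Ioo 0 (m + 1), g k =
      ∑ j ∈ Ioo 0 n, c j * ((1 - ζ ^ j)⁻¹ - 1) *
        (∑ m ∈ Ioo 0 n, F m - ∑ m ∈ Ioo 0 n, F m * ζ ^ (j * m)) := by
  have inner : ∀ m ∈ Ioo 0 n, F m * ∑ k ∈ Ioo 0 (m + 1), g k =
      ∑ j ∈ Ioo 0 n, c j * ((1 - ζ ^ j)⁻¹ - 1) * (F m - F m * ζ ^ (j * m)) := by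
    intro m hm
    have : ∑ k ∈ Ioo 0 (m + 1), g k =
        ∑ k ∈ Ioo 0 (m + 1), ∑ j ∈ Ioo 0 n, c j * ζ ^ (j * k) :=
      sum_congr rfl fun k hk => hg k (by simp at hm hk ⊢; omega)
    rw [this, sum_comm, mul_sum]
    refine sum_congr rfl fun j hj => ?_
    rw [← mul_sum, sum_Ioo_pow_mul hζ hj]
    ring
  rw [sum_congr rfl inner, sum_comm]
  refine sum_congr rfl fun j _ => ?_
  rw [← mul_sum, sum_sub_distrib]

lemma geomInvDFT_zero (hζ : IsPrimitiveRoot ζ n) {j : ℕ} (hj : j ∈ Ioo 0 n) :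
    geomInvDFT ζ n 0 j = -1 := by
  have h0 := one_sub_pow_ne_zero hζ hj
  obtain ⟨n, rfl⟩ : ∃ k, n = k + 1 := ⟨n - 1, by simp at hj; omega⟩
  have h : ζ ^ (j * n) * ζ ^ j = 1 := by
    rw [← pow_add, ← Nat.mul_succ, mul_comm, pow_mul, hζ.pow_eq_one, one_pow]
  simp only [geomInvDFT, pow_zero, one_mul]
  rw [sum_Ioo_pow_mul hζ hj]
  field_simp
  linear_combination -h

lemma geomInvDFT_succ (hζ : IsPrimitiveRoot ζ n) (s j : ℕ) :
    geomInvDFT ζ n (s + 1) (j + 1) = geomInvDFT ζ n (s + 1) j - geomInvDFT ζ n s j := by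
  simp only [geomInvDFT, ← sum_sub_distrib]
  refine sum_congr rfl fun m hm => ?_
  have h0 := one_sub_pow_ne_zero hζ hm
  rw [add_mul, one_mul, pow_add ζ, pow_succ]
  linear_combination -((1 - ζ ^ m)⁻¹ ^ s * ζ ^ (j * m)) * inv_mul_cancel₀ h0

lemma geomInvDFT_self (hζ : IsPrimitiveRoot ζ n) (s : ℕ) :
    geomInvDFT ζ n s n = ∑ m ∈ Ioo 0 n, ((1 - ζ ^ m)⁻¹) ^ s := by
  refine sum_congr rfl fun m _ => ?_
  rw [pow_mul, hζ.pow_eq_one, one_pow, mul_one]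

lemma sum_range_geomInvDFT (hζ : IsPrimitiveRoot ζ n) (s : ℕ) :
    ∑ j ∈ range n, geomInvDFT ζ n s (j + 1) = 0 := by
  simp only [geomInvDFT]
  rw [sum_comm]
  refine sum_eq_zero fun m hm => ?_
  have h0 := one_sub_pow_ne_zero hζ hm
  have h := mul_neg_geom_sum (ζ ^ m) n
  rw [pow_pow_eq_one hζ, sub_self] at h
  have h' := (mul_eq_zero.1 h).resolve_left h0
  calc _ = ((1 - ζ ^ m)⁻¹) ^ s * ζ ^ m * ∑ j ∈ range n, (ζ ^ m) ^ j := by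
        rw [mul_sum]
        refine sum_congr rfl fun j _ => ?_
        rw [add_mul, one_mul, pow_add, mul_comm j m, pow_mul]; ring
    _ = 0 := by rw [h', mul_zero]

lemma geomInvDFT_succ_eq (hn : n ≠ 0) (hζ : IsPrimitiveRoot ζ n) {s : ℕ} {p q : ℕ → ℂ}
    (hp : ∀ j ∈ Ioo 0 n, geomInvDFT ζ n s j = p j) (hq : ∀ j, q (j + 1) = q j - p j)
    (hsum : ∑ j ∈ range n, q (j + 1) = 0) :
    ∀ j < n, geomInvDFT ζ n (s + 1) (j + 1) = q (j + 1) := by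
  have key : ∀ j < n, geomInvDFT ζ n (s + 1) (j + 1) =
      q (j + 1) + (geomInvDFT ζ n (s + 1) 1 - q 1) := by
    intro j hj
    induction j with
    | zero => ring
    | succ j ih =>
      rw [geomInvDFT_succ hζ, ih (by omega), hp _ (by simp; omega), hq (j + 1)]
      ring
  have h := sum_range_geomInvDFT hζ (s + 1)
  rw [sum_congr rfl fun j hj => key j (mem_range.1 hj), sum_add_distrib, hsum, sum_const,
    card_range, zero_add, nsmul_eq_mul] at h
  have h' := (mul_eq_zero.1 h).resolve_left (by exact_mod_cast hn)
  intro j hj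
  rw [key j hj, h', add_zero]

lemma geomInvDFT_one (hn : n ≠ 0) (hζ : IsPrimitiveRoot ζ n) :
    ∀ j < n, geomInvDFT ζ n 1 (j + 1) = (2 * (j + 1 : ℕ) - 1 - n) / 2 := by
  refine geomInvDFT_succ_eq (q := fun j => (2 * (j : ℂ) - 1 - n) / 2) hn hζ
    (fun j hj => geomInvDFT_zero hζ hj) (fun j => by push_cast; ring) ?_
  have : ∀ N : ℕ, ∑ j ∈ range N, (2 * ((j + 1 : ℕ) : ℂ) - 1 - n) / 2 =
      (N ^ 2 - n * N) / 2 := by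
    intro N
    induction N with
    | zero => simp
    | succ N ih => rw [sum_range_succ, ih]; push_cast; ring
  rw [this]; ring

lemma geomInvDFT_two (hn : n ≠ 0) (hζ : IsPrimitiveRoot ζ n) :
    ∀ j < n, geomInvDFT ζ n 2 (j + 1) =
      (-5 + 12 * (j + 1 : ℕ) - 6 * (j + 1 : ℕ) ^ 2 - 6 * n + 6 * n * (j + 1 : ℕ) - n ^ 2) / 12 := by
  refine geomInvDFT_succ_eq
    (q := fun j => (-5 + 12 * (j : ℂ) - 6 * j ^ 2 - 6 * n + 6 * n * j - n ^ 2) / 12)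
    (p := fun j => (2 * (j : ℂ) - 1 - n) / 2) hn hζ ?_ (fun j => by push_cast; ring) ?_
  · intro j hj
    rw [mem_Ioo] at hj
    obtain ⟨j, rfl⟩ := Nat.exists_eq_succ_of_ne_zero hj.1.ne'
    exact geomInvDFT_one hn hζ j (by omega)
  have : ∀ N : ℕ, ∑ j ∈ range N, (-5 + 12 * ((j + 1 : ℕ) : ℂ) - 6 * (j + 1 : ℕ) ^ 2 - 6 * n +
      6 * n * (j + 1 : ℕ) - n ^ 2) / 12 =
      (3 * (N : ℂ) ^ 2 - 2 * N ^ 3 - 3 * n * N + 3 * n * N ^ 2 - n ^ 2 * N) / 12 := by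
    intro N
    induction N with
    | zero => simp
    | succ N ih => rw [sum_range_succ, ih]; push_cast; ring
  rw [this]; ring

lemma geomInvDFT_three (hn : n ≠ 0) (hζ : IsPrimitiveRoot ζ n) :
    ∀ j < n, geomInvDFT ζ n 3 (j + 1) =
      (-9 + 24 * (j + 1 : ℕ) - 18 * (j + 1 : ℕ) ^ 2 + 4 * (j + 1 : ℕ) ^ 3 - 12 * n
        + 18 * n * (j + 1 : ℕ) - 6 * n * (j + 1 : ℕ) ^ 2 - 3 * n ^ 2
        + 2 * n ^ 2 * (j + 1 : ℕ)) / 24 := by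
  refine geomInvDFT_succ_eq
    (q := fun j => (-9 + 24 * (j : ℂ) - 18 * j ^ 2 + 4 * j ^ 3 - 12 * n
        + 18 * n * j - 6 * n * j ^ 2 - 3 * n ^ 2 + 2 * n ^ 2 * j) / 24)
    (p := fun j => (-5 + 12 * (j : ℂ) - 6 * j ^ 2 - 6 * n + 6 * n * j - n ^ 2) / 12)
    hn hζ ?_ (fun j => by push_cast; ring) ?_
  · intro j hj
    rw [mem_Ioo] at hj
    obtain ⟨j, rfl⟩ := Nat.exists_eq_succ_of_ne_zero hj.1.ne'
    exact geomInvDFT_two hn hζ j (by omega)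
  have : ∀ N : ℕ, ∑ j ∈ range N, (-9 + 24 * ((j + 1 : ℕ) : ℂ) - 18 * (j + 1 : ℕ) ^ 2
      + 4 * (j + 1 : ℕ) ^ 3 - 12 * n + 18 * n * (j + 1 : ℕ) - 6 * n * (j + 1 : ℕ) ^ 2
      - 3 * n ^ 2 + 2 * n ^ 2 * (j + 1 : ℕ)) / 24 =
      (4 * (N : ℂ) ^ 2 - 4 * N ^ 3 + N ^ 4 - 4 * n * N + 6 * n * N ^ 2 - 2 * n * N ^ 3
        - 2 * n ^ 2 * N + n ^ 2 * N ^ 2) / 24 := by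
    intro N
    induction N with
    | zero => simp
    | succ N ih => rw [sum_range_succ, ih]; push_cast; ring
  rw [this]; ring

lemma geomInvDFT_four (hn : n ≠ 0) (hζ : IsPrimitiveRoot ζ n) :
    ∀ j < n, geomInvDFT ζ n 4 (j + 1) =
      (-251 + 720 * (j + 1 : ℕ) - 660 * (j + 1 : ℕ) ^ 2 + 240 * (j + 1 : ℕ) ^ 3
        - 30 * (j + 1 : ℕ) ^ 4 - 360 * n + 660 * n * (j + 1 : ℕ) - 360 * n * (j + 1 : ℕ) ^ 2
        + 60 * n * (j + 1 : ℕ) ^ 3 - 110 * n ^ 2 + 120 * n ^ 2 * (j + 1 : ℕ)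
        - 30 * n ^ 2 * (j + 1 : ℕ) ^ 2 + n ^ 4) / 720 := by
  refine geomInvDFT_succ_eq
    (q := fun j => (-251 + 720 * (j : ℂ) - 660 * j ^ 2 + 240 * j ^ 3 - 30 * j ^ 4 - 360 * n
        + 660 * n * j - 360 * n * j ^ 2 + 60 * n * j ^ 3 - 110 * n ^ 2 + 120 * n ^ 2 * j
        - 30 * n ^ 2 * j ^ 2 + n ^ 4) / 720)
    (p := fun j => (-9 + 24 * (j : ℂ) - 18 * j ^ 2 + 4 * j ^ 3 - 12 * n
        + 18 * n * j - 6 * n * j ^ 2 - 3 * n ^ 2 + 2 * n ^ 2 * j) / 24)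
    hn hζ ?_ (fun j => by push_cast; ring) ?_
  · intro j hj
    rw [mem_Ioo] at hj
    obtain ⟨j, rfl⟩ := Nat.exists_eq_succ_of_ne_zero hj.1.ne'
    exact geomInvDFT_three hn hζ j (by omega)
  have : ∀ N : ℕ, ∑ j ∈ range N, (-251 + 720 * ((j + 1 : ℕ) : ℂ) - 660 * (j + 1 : ℕ) ^ 2
      + 240 * (j + 1 : ℕ) ^ 3 - 30 * (j + 1 : ℕ) ^ 4 - 360 * n + 660 * n * (j + 1 : ℕ)
      - 360 * n * (j + 1 : ℕ) ^ 2 + 60 * n * (j + 1 : ℕ) ^ 3 - 110 * n ^ 2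
      + 120 * n ^ 2 * (j + 1 : ℕ) - 30 * n ^ 2 * (j + 1 : ℕ) ^ 2 + n ^ 4) / 720 =
      (90 * (N : ℂ) ^ 2 - 110 * N ^ 3 + 45 * N ^ 4 - 6 * N ^ 5 - 90 * n * N + 165 * n * N ^ 2
        - 90 * n * N ^ 3 + 15 * n * N ^ 4 - 55 * n ^ 2 * N + 45 * n ^ 2 * N ^ 2
        - 10 * n ^ 2 * N ^ 3 + n ^ 4 * N) / 720 := by
    intro N
    induction N with
    | zero => simp
    | succ N ih => rw [sum_range_succ, ih]; push_cast; ring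
  rw [this]; ring

/-- A reflection-invariant weight averages `1 / (1 - ζ ^ j)` to `1 / 2`. -/
lemma sum_symm_mul_inv_one_sub_pow (hζ : IsPrimitiveRoot ζ n) {w : ℕ → ℂ}
    (hw : ∀ j ∈ Ioo 0 n, w (n - j) = w j) :
    ∑ j ∈ Ioo 0 n, w j * ((1 - ζ ^ j)⁻¹ - 1) = -(∑ j ∈ Ioo 0 n, w j) / 2 := by
  have h : ∑ j ∈ Ioo 0 n, w j * ((1 - ζ ^ j)⁻¹ - 1) =
      ∑ j ∈ Ioo 0 n, w j * -(1 - ζ ^ j)⁻¹ := by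
    refine sum_nbij' (fun j => n - j) (fun j => n - j) ?_ ?_ ?_ ?_ ?_
    · intro j hj; simp at hj ⊢; omega
    · intro j hj; simp at hj ⊢; omega
    · intro j hj; simp at hj; omega
    · intro j hj; simp at hj; omega
    · intro j hj
      have hj' : n - j ∈ Ioo 0 n := by simp at hj ⊢; omega
      have h0 := one_sub_pow_ne_zero hζ hj
      have h1 := one_sub_pow_ne_zero hζ hj'
      have h2 : ζ ^ j * ζ ^ (n - j) = 1 := by
        rw [← pow_add, Nat.add_sub_cancel' (by simp at hj; omega), hζ.pow_eq_one]
      rw [hw j hj]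
      congr 1
      field_simp
      linear_combination -h2
  have h' : ∑ j ∈ Ioo 0 n, w j * ((1 - ζ ^ j)⁻¹ - 1) +
      ∑ j ∈ Ioo 0 n, w j * -(1 - ζ ^ j)⁻¹ = -∑ j ∈ Ioo 0 n, w j := by
    rw [← sum_add_distrib, ← sum_neg_distrib]
    exact sum_congr rfl fun j _ => by ring
  linear_combination (1 / 2 : ℂ) * h + (1 / 2 : ℂ) * h'

lemma zqStar_pair (q : ℂ) (k l n : ℕ) :
    zqStar q [k, l] n = ∑ m ∈ Ioo 0 n, q ^ ((k - 1) * m) / qint q m ^ k *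
      ∑ i ∈ Ioo 0 (m + 1), q ^ ((l - 1) * i) / qint q i ^ l := by
  simp [zqStar]

lemma pow_mul_div_qint_pow (hζ : IsPrimitiveRoot ζ n) {m : ℕ} (hm : m ∈ Ioo 0 n) (k : ℕ) :
    ζ ^ (k * m) / qint ζ m ^ (k + 1) =
      (1 - ζ) ^ (k + 1) * (((1 - ζ ^ m)⁻¹ - 1) ^ k * (1 - ζ ^ m)⁻¹) := by
  have h0 := one_sub_pow_ne_zero hζ hm
  have h : (1 - ζ ^ m)⁻¹ - 1 = ζ ^ m * (1 - ζ ^ m)⁻¹ := by field_simp; ring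
  rw [h, qint, div_pow, mul_comm k m, pow_mul, div_div_eq_mul_div, mul_pow, div_eq_mul_inv,
    ← inv_pow]
  ring

lemma zqStar_pair_eq (hζ : IsPrimitiveRoot ζ n) (k l : ℕ) :
    zqStar ζ [k + 1, l + 1] n = (1 - ζ) ^ (k + l + 2) *
      ∑ m ∈ Ioo 0 n, (((1 - ζ ^ m)⁻¹ - 1) ^ k * (1 - ζ ^ m)⁻¹) *
        ∑ i ∈ Ioo 0 (m + 1), (((1 - ζ ^ i)⁻¹ - 1) ^ l * (1 - ζ ^ i)⁻¹) := by
  rw [zqStar_pair, mul_sum]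
  refine sum_congr rfl fun m hm => ?_
  have : ∑ i ∈ Ioo 0 (m + 1), ζ ^ ((l + 1 - 1) * i) / qint ζ i ^ (l + 1) =
      (1 - ζ) ^ (l + 1) *
        ∑ i ∈ Ioo 0 (m + 1), (((1 - ζ ^ i)⁻¹ - 1) ^ l * (1 - ζ ^ i)⁻¹) := by
    rw [mul_sum]
    refine sum_congr rfl fun i hi => ?_
    exact pow_mul_div_qint_pow hζ (by simp at hm hi ⊢; omega) l
  rw [this, Nat.add_sub_cancel, pow_mul_div_qint_pow hζ hm]
  ring

lemma zqStar_two_one (hn : n ≠ 0) (hζ : IsPrimitiveRoot ζ n) :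
    zqStar ζ [2, 1] n = (1 - ζ) ^ 3 * ∑ j ∈ Ioo 0 n,
      (j : ℂ) * (j * (n - j)) / (2 * n) * ((1 - ζ ^ j)⁻¹ - 1) := by
  rw [zqStar_pair_eq hζ 1 0, sum_mul_sum_eq_of_fourier hζ _ _ (fun j => -(j : ℂ) / n)
    fun k hk => by rw [pow_zero, one_mul, inv_one_sub_pow_eq_sum hn hζ hk]]
  congr 1
  refine sum_congr rfl fun j hj => ?_
  obtain ⟨i, rfl⟩ := Nat.exists_eq_succ_of_ne_zero (mem_Ioo.1 hj).1.ne'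
  obtain ⟨N, rfl⟩ := Nat.exists_eq_succ_of_ne_zero hn
  have hi : i < N.succ := by simp at hj; omega
  have e : ∀ r, ∑ m ∈ Ioo 0 N.succ, ((1 - ζ ^ m)⁻¹ - 1) ^ 1 * (1 - ζ ^ m)⁻¹ * ζ ^ (r * m) =
      geomInvDFT ζ N.succ 2 r - geomInvDFT ζ N.succ 1 r := by
    intro r
    simp only [geomInvDFT, ← sum_sub_distrib]
    exact sum_congr rfl fun m _ => by ring
  have e0 := e N.succ
  simp only [pow_mul ζ N.succ, hζ.pow_eq_one, one_pow, mul_one] at e0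
  rw [e, e0, geomInvDFT_two hn hζ i hi, geomInvDFT_one hn hζ i hi,
    geomInvDFT_two hn hζ N N.lt_succ_self, geomInvDFT_one hn hζ N N.lt_succ_self]
  simp only [Nat.succ_eq_add_one]
  ring

lemma zqStar_three_two (hn : n ≠ 0) (hζ : IsPrimitiveRoot ζ n) :
    zqStar ζ [3, 2] n = (1 - ζ) ^ 5 * ∑ j ∈ Ioo 0 n,
      (j : ℂ) * (n - j) / (2 * n) * ((j * (n - j)) * (2 * j + 3 - n) / 12) *
        ((1 - ζ ^ j)⁻¹ - 1) := by
  rw [zqStar_pair_eq hζ 2 1, sum_mul_sum_eq_of_fourier hζ _ _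
    (fun j => (j : ℂ) * (n - j) / (2 * n))
    fun k hk => by rw [← inv_one_sub_pow_sq_sub_eq_sum hn hζ hk]; ring]
  congr 1
  refine sum_congr rfl fun j hj => ?_
  obtain ⟨i, rfl⟩ := Nat.exists_eq_succ_of_ne_zero (mem_Ioo.1 hj).1.ne'
  obtain ⟨N, rfl⟩ := Nat.exists_eq_succ_of_ne_zero hn
  have hi : i < N.succ := by simp at hj; omega
  have e : ∀ r, ∑ m ∈ Ioo 0 N.succ, ((1 - ζ ^ m)⁻¹ - 1) ^ 2 * (1 - ζ ^ m)⁻¹ * ζ ^ (r * m) =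
      geomInvDFT ζ N.succ 3 r - 2 * geomInvDFT ζ N.succ 2 r + geomInvDFT ζ N.succ 1 r := by
    intro r
    simp only [geomInvDFT, mul_sum, ← sum_sub_distrib, ← sum_add_distrib]
    exact sum_congr rfl fun m _ => by ring
  have e0 := e N.succ
  simp only [pow_mul ζ N.succ, hζ.pow_eq_one, one_pow, mul_one] at e0
  rw [e, e0, geomInvDFT_three hn hζ i hi, geomInvDFT_two hn hζ i hi, geomInvDFT_one hn hζ i hi,
    geomInvDFT_three hn hζ N N.lt_succ_self, geomInvDFT_two hn hζ N N.lt_succ_self,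
    geomInvDFT_one hn hζ N N.lt_succ_self]
  simp only [Nat.succ_eq_add_one]
  ring

lemma zqStar_four_one (hn : n ≠ 0) (hζ : IsPrimitiveRoot ζ n) :
    zqStar ζ [4, 1] n = (1 - ζ) ^ 5 * ∑ j ∈ Ioo 0 n,
      -(j : ℂ) / n * ((4 * j ^ 2 + 4 * j ^ 3 + j ^ 4 - 4 * n * j - 6 * n * j ^ 2 - 2 * n * j ^ 3
        + 2 * n ^ 2 * j + n ^ 2 * j ^ 2) / 24) * ((1 - ζ ^ j)⁻¹ - 1) := by
  rw [zqStar_pair_eq hζ 3 0, sum_mul_sum_eq_of_fourier hζ _ _ (fun j => -(j : ℂ) / n)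
    fun k hk => by rw [pow_zero, one_mul, inv_one_sub_pow_eq_sum hn hζ hk]]
  congr 1
  refine sum_congr rfl fun j hj => ?_
  obtain ⟨i, rfl⟩ := Nat.exists_eq_succ_of_ne_zero (mem_Ioo.1 hj).1.ne'
  obtain ⟨N, rfl⟩ := Nat.exists_eq_succ_of_ne_zero hn
  have hi : i < N.succ := by simp at hj; omega
  have e : ∀ r, ∑ m ∈ Ioo 0 N.succ, ((1 - ζ ^ m)⁻¹ - 1) ^ 3 * (1 - ζ ^ m)⁻¹ * ζ ^ (r * m) =
      geomInvDFT ζ N.succ 4 r - 3 * geomInvDFT ζ N.succ 3 r + 3 * geomInvDFT ζ N.succ 2 r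
        - geomInvDFT ζ N.succ 1 r := by
    intro r
    simp only [geomInvDFT, mul_sum, ← sum_sub_distrib, ← sum_add_distrib]
    exact sum_congr rfl fun m _ => by ring
  have e0 := e N.succ
  simp only [pow_mul ζ N.succ, hζ.pow_eq_one, one_pow, mul_one] at e0
  rw [e, e0, geomInvDFT_four hn hζ i hi, geomInvDFT_three hn hζ i hi, geomInvDFT_two hn hζ i hi,
    geomInvDFT_one hn hζ i hi, geomInvDFT_four hn hζ N N.lt_succ_self,
    geomInvDFT_three hn hζ N N.lt_succ_self, geomInvDFT_two hn hζ N N.lt_succ_self,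
    geomInvDFT_one hn hζ N N.lt_succ_self]
  simp only [Nat.succ_eq_add_one]
  ring

end

/-- For every `n ≥ 1` and every primitive `n`-th root of unity `ζ_n`:
`2·z_n^⋆(4,1;ζ_n) + z_n^⋆(3,2;ζ_n)
  = ((n⁴-1)(n+5)/1440)·(1-ζ_n)⁵ + ((n+2)/3)·(1-ζ_n)²·z_n^⋆(2,1;ζ_n)`. -/
theorem stmt_16 (n : ℕ) (hn : 1 ≤ n) (ζ : ℂ) (hζ : IsPrimitiveRoot ζ n) :
    2 * zqStar ζ [4, 1] n + zqStar ζ [3, 2] n =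
      (((n : ℂ) ^ 4 - 1) * ((n : ℂ) + 5) / 1440) * (1 - ζ) ^ 5 +
        (((n : ℂ) + 2) / 3) * (1 - ζ) ^ 2 * zqStar ζ [2, 1] n := by
  have hn0 : n ≠ 0 := by omega
  have hn' : (n : ℂ) ≠ 0 := by exact_mod_cast hn0
  have hsymm := sum_symm_mul_inv_one_sub_pow hζ (w := fun j => ((j : ℂ) * (n - j)) ^ 2) (by
    intro j hj
    rw [Nat.cast_sub (by simp at hj; omega)]
    ring)
  rw [sum_Ioo_zero_eq_sum_range (f := fun j => ((j : ℂ) * (n - j)) ^ 2) (by simp),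
    sum_range_sq_mul_sub_sq] at hsymm
  have hcomb : 2 * (∑ j ∈ Ioo 0 n, -(j : ℂ) / n * ((4 * j ^ 2 + 4 * j ^ 3 + j ^ 4 - 4 * n * j
        - 6 * n * j ^ 2 - 2 * n * j ^ 3 + 2 * n ^ 2 * j + n ^ 2 * j ^ 2) / 24) *
        ((1 - ζ ^ j)⁻¹ - 1)) +
      (∑ j ∈ Ioo 0 n, (j : ℂ) * (n - j) / (2 * n) * ((j * (n - j)) * (2 * j + 3 - n) / 12) *
        ((1 - ζ ^ j)⁻¹ - 1)) -
      (n + 2) / 3 * (∑ j ∈ Ioo 0 n, (j : ℂ) * (j * (n - j)) / (2 * n) * ((1 - ζ ^ j)⁻¹ - 1)) =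
      -(n + 5) / (24 * n) *
        ∑ j ∈ Ioo 0 n, ((j : ℂ) * (n - j)) ^ 2 * ((1 - ζ ^ j)⁻¹ - 1) := by
    simp only [mul_sum, ← sum_sub_distrib, ← sum_add_distrib]
    refine sum_congr rfl fun j _ => ?_
    field_simp
    ring
  rw [hsymm] at hcomb
  rw [zqStar_four_one hn0 hζ, zqStar_three_two hn0 hζ, zqStar_two_one hn0 hζ]
  have hval : -((n : ℂ) + 5) / (24 * n) * (-(n * (n - 1) * (2 * n - 1) / 6 * n ^ 2
      - (n * (n - 1)) ^ 2 / 2 * n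
      + n * (n - 1) * (2 * n - 1) * (3 * n ^ 2 - 3 * n - 1) / 30) / 2) =
      (n ^ 4 - 1) * (n + 5) / 1440 := by
    field_simp
    ring
  linear_combination (1 - ζ) ^ 5 * (hcomb + hval)
end

section
/- Let r ≥ 1 and let a_1,…,a_r, b_1,…,b_r be positive integers, and let k = [a_1,…,a_r;b_1,…,b_r] and k' = [b_r,…,b_1;a_r,…,a_1]. Then there exists an integer N such that for every prime p > N, the congruence ∑_{p>m_1≥⋯≥m_s>0} ∏_j (m_j)^{−k_j} ≡ (−1)^{a_1+⋯+a_r+b_1+⋯+b_r} · ∑_{p>m_1≥⋯≥m_{s'}>0} ∏_j (m_j)^{−k'_j} (mod p) holds in 𝔽_p, where (k_1,…,k_s) and (k'_1,…,k'_{s'}) are the entries of k and k'. (This is Hoffman's duality ζ_𝒜^⋆(k) = −ζ_𝒜^⋆(k^∨) combined with the reversal relation, since the reverse of the Hoffman dual of [a_1,…,a_r;b_1,…,b_r] is [b_r,…,b_1;a_r,…,a_1].) -/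
/-- The truncated multiple harmonic star sum
`∑_{n > m_1 ≥ ⋯ ≥ m_s > 0} ∏_j (m_j mod p)^{-k_j}` in `𝔽_p = ZMod p`. -/
def mhsStar (p : ℕ) : List ℕ → ℕ → ZMod p
  | [], _ => 1
  | k :: ks, n => ∑ m ∈ Finset.Ioo 0 n, ((m : ZMod p)⁻¹) ^ k * mhsStar p ks (m + 1)

/-- The index `[a_1,…,a_r; b_1,…,b_r]`, i.e.
`({1}^{a_1-1}, b_1+1, …, {1}^{a_{r-1}-1}, b_{r-1}+1, {1}^{a_r-1}, b_r)`. -/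
def abIndex : List ℕ → List ℕ → List ℕ
  | [a], [b] => List.replicate (a - 1) 1 ++ [b]
  | a :: as, b :: bs => List.replicate (a - 1) 1 ++ [b + 1] ++ abIndex as bs
  | _, _ => []

open Finset

/-- The two letters acting on sequences: `false` divides the `i`-th term by `i + 1`, and `true`
first takes partial sums and then divides. Sequences are indexed from `0`, so that the `i`-th term
stands for the summand with largest summation variable `i + 1`. -/
def letterOp (p : ℕ) : Bool → (ℕ → ZMod p) → ℕ → ZMod p
  | false, f, i => ((i + 1 : ℕ) : ZMod p)⁻¹ * f i
  | true, f, i => ((i + 1 : ℕ) : ZMod p)⁻¹ * ∑ j ∈ range (i + 1), f j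

/-- A word in the two letters applied to the sequence `1 / (i + 1)`. -/
def wordSeq (p : ℕ) (w : List Bool) : ℕ → ZMod p :=
  w.foldr (letterOp p) fun i => ((i + 1 : ℕ) : ZMod p)⁻¹

/-- The word encoding an index. -/
def indexWord : List ℕ → List Bool
  | [] => []
  | [k] => List.replicate (k - 1) false
  | k :: l :: ls => List.replicate (k - 1) false ++ true :: indexWord (l :: ls)

/-- The word `true^{a_1} false^{b_1} ⋯ true^{a_r} false^{b_r}`. -/
def abWord (a b : List ℕ) : List Bool :=
  (List.zipWith (fun x y => List.replicate x true ++ List.replicate y false) a b).flatten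

/-- The alternating binomial transform. -/
def binomTransform (p : ℕ) (f : ℕ → ZMod p) (i : ℕ) : ZMod p :=
  ∑ m ∈ range (i + 1), (-1) ^ m * (i.choose m : ZMod p) * f m

theorem natCast_zmod_ne_zero {p i : ℕ} (hi : i + 1 < p) : ((i + 1 : ℕ) : ZMod p) ≠ 0 := by
  rw [Ne, ZMod.natCast_eq_zero_iff]
  exact Nat.not_dvd_of_pos_of_lt (Nat.succ_pos i) hi

theorem sum_binomTransform (p : ℕ) (f : ℕ → ZMod p) (n : ℕ) :
    ∑ i ∈ range n, binomTransform p f i =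
      ∑ m ∈ range n, (-1) ^ m * (n.choose (m + 1) : ZMod p) * f m := by
  induction n with
  | zero => simp
  | succ n ih =>
    have h : ∑ m ∈ range n, (-1) ^ m * (n.choose (m + 1) : ZMod p) * f m =
        ∑ m ∈ range (n + 1), (-1) ^ m * (n.choose (m + 1) : ZMod p) * f m := by
      rw [sum_range_succ, Nat.choose_succ_self]
      simp
    rw [sum_range_succ, ih, h, binomTransform, ← sum_add_distrib]
    refine sum_congr rfl fun m _ => ?_
    rw [Nat.choose_succ_succ]
    push_cast
    ring

theorem sum_choose_mul_partialSum {R : Type*} [CommRing R] (f : ℕ → R) (i n : ℕ) :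
    ∑ m ∈ range n, (-1) ^ m * ((i + 1).choose (m + 1) : R) * ∑ j ∈ range (m + 1), f j =
      ∑ m ∈ range n, (-1) ^ m * (i.choose m : R) * f m -
        (-1) ^ n * (i.choose n : R) * ∑ j ∈ range n, f j := by
  induction n with
  | zero => simp
  | succ n ih =>
    rw [sum_range_succ, ih, sum_range_succ (fun m => (-1) ^ m * (i.choose m : R) * f m) n,
      sum_range_succ f n, Nat.choose_succ_succ]
    push_cast
    ring

theorem choose_mul_inv {p i m : ℕ} [Fact p.Prime] (hi : i + 1 < p) (hm : m ≤ i) :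
    (i.choose m : ZMod p) * ((m + 1 : ℕ) : ZMod p)⁻¹ =
      ((i + 1 : ℕ) : ZMod p)⁻¹ * ((i + 1).choose (m + 1) : ZMod p) := by
  have h1 := natCast_zmod_ne_zero hi
  have h2 := natCast_zmod_ne_zero (show m + 1 < p by omega)
  have h3 : ((i + 1 : ℕ) : ZMod p) * (i.choose m : ZMod p) =
      ((i + 1).choose (m + 1) : ZMod p) * ((m + 1 : ℕ) : ZMod p) := by
    exact_mod_cast congrArg (Nat.cast : ℕ → ZMod p) (Nat.add_one_mul_choose_eq i m)
  rw [← div_eq_mul_inv, inv_mul_eq_div, div_eq_div_iff h2 h1, mul_comm, h3]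

/-- The binomial transform exchanges the two letters. -/
theorem binomTransform_letterOp {p i : ℕ} [Fact p.Prime] (hi : i + 1 < p) (x : Bool)
    (f : ℕ → ZMod p) :
    binomTransform p (letterOp p x f) i = letterOp p (!x) (binomTransform p f) i := by
  have key (g : ℕ → ZMod p) :
      ∑ m ∈ range (i + 1), (-1) ^ m * (i.choose m : ZMod p) * (((m + 1 : ℕ) : ZMod p)⁻¹ * g m) =
        ((i + 1 : ℕ) : ZMod p)⁻¹ *
          ∑ m ∈ range (i + 1), (-1) ^ m * ((i + 1).choose (m + 1) : ZMod p) * g m := by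
    rw [mul_sum]
    refine sum_congr rfl fun m hm => ?_
    linear_combination (-1) ^ m * g m *
      choose_mul_inv hi (Nat.lt_succ_iff.1 (mem_range.1 hm))
  cases x with
  | false =>
    simp only [letterOp, Bool.not_false, sum_binomTransform]
    exact key f
  | true =>
    simp only [letterOp, Bool.not_true]
    rw [binomTransform]
    simp only [letterOp]
    rw [key, sum_choose_mul_partialSum, Nat.choose_succ_self]
    simp [binomTransform]

theorem letterOp_congr {p n : ℕ} {f g : ℕ → ZMod p} (h : ∀ i, i + 1 < n → f i = g i) (x : Bool)
    {i : ℕ} (hi : i + 1 < n) : letterOp p x f i = letterOp p x g i := by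
  cases x with
  | false => simp only [letterOp, h i hi]
  | true =>
    simp only [letterOp]
    congr 1
    refine sum_congr rfl fun j hj => h j ?_
    have := mem_range.1 hj
    omega

theorem binomTransform_wordSeq {p : ℕ} [Fact p.Prime] (w : List Bool) :
    ∀ i, i + 1 < p → binomTransform p (wordSeq p w) i = wordSeq p (w.map (!·)) i := by
  induction w with
  | nil =>
    intro i hi
    simp only [wordSeq, List.map_nil, List.foldr_nil, binomTransform]
    have h : ∑ m ∈ range (i + 1), (-1) ^ m * ((i + 1).choose (m + 1) : ZMod p) = 1 := by
      have := sum_choose_mul_partialSum (fun m => if m = 0 then (1 : ZMod p) else 0) i (i + 1)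
      simpa using this
    rw [sum_congr rfl fun m hm => by
      rw [mul_assoc, choose_mul_inv hi (Nat.lt_succ_iff.1 (mem_range.1 hm)), mul_left_comm],
      ← mul_sum, h, mul_one]
  | cons x w ih =>
    intro i hi
    exact (binomTransform_letterOp hi x (wordSeq p w)).trans (letterOp_congr ih _ hi)

theorem choose_prime_sub_one (q : ℕ) [hp : Fact (q + 1).Prime] {m : ℕ} (hm : m ≤ q) :
    (q.choose m : ZMod (q + 1)) = (-1) ^ m := by
  induction m with
  | zero => simp
  | succ m ih =>
    have h : (((q + 1).choose (m + 1) : ℕ) : ZMod (q + 1)) = 0 := by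
      rw [ZMod.natCast_eq_zero_iff]
      exact hp.out.dvd_choose_self (by omega) (by omega)
    rw [Nat.choose_succ_succ] at h
    push_cast at h
    rw [ih (by omega)] at h
    rw [pow_succ]
    linear_combination h

/-- Hoffman's duality. -/
theorem sum_wordSeq_map_not (q : ℕ) [Fact (q + 1).Prime] (w : List Bool) :
    ∑ i ∈ range q, wordSeq (q + 1) (w.map (!·)) i = -∑ i ∈ range q, wordSeq (q + 1) w i := by
  have h : ∀ i ∈ range q, wordSeq (q + 1) (w.map (!·)) i =
      binomTransform (q + 1) (wordSeq (q + 1) w) i := fun i hi =>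
    (binomTransform_wordSeq w i (by simpa using hi)).symm
  rw [sum_congr rfl h, sum_binomTransform, ← sum_neg_distrib]
  refine sum_congr rfl fun m hm => ?_
  rw [choose_prime_sub_one q (mem_range.1 hm), ← pow_add,
    Odd.neg_one_pow ⟨m, by omega⟩, neg_one_mul]

/-- The pairing for which each letter is anti-self-adjoint. -/
def reflectPairing (q : ℕ) (f g : ℕ → ZMod (q + 1)) : ZMod (q + 1) :=
  ∑ i ∈ range q, ((i + 1 : ℕ) : ZMod (q + 1)) * f i * g (q - 1 - i)

theorem natCast_mul_inv_reflect {q i : ℕ} [Fact (q + 1).Prime] (hi : i < q) :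
    ((i + 1 : ℕ) : ZMod (q + 1)) * ((q - 1 - i + 1 : ℕ) : ZMod (q + 1))⁻¹ = -1 := by
  have h := natCast_zmod_ne_zero (p := q + 1) (i := q - 1 - i) (by omega)
  have h0 : ((i + 1 : ℕ) : ZMod (q + 1)) + ((q - 1 - i + 1 : ℕ) : ZMod (q + 1)) = 0 := by
    rw [← Nat.cast_add, show i + 1 + (q - 1 - i + 1) = q + 1 by omega, ZMod.natCast_self]
  rw [mul_inv_eq_iff_eq_mul₀ h]
  linear_combination h0

theorem sum_partialSum_mul_reflect {R : Type*} [CommRing R] (q : ℕ) (f g : ℕ → R) :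
    ∑ i ∈ range q, (∑ j ∈ range (i + 1), f j) * g (q - 1 - i) =
      ∑ i ∈ range q, f i * ∑ j ∈ range (q - 1 - i + 1), g j := by
  rw [← sum_range_reflect]
  simp only [sum_mul, mul_sum]
  rw [sum_comm' (t' := range q) (s' := fun i => range (q - 1 - i + 1))]
  · refine sum_congr rfl fun i hi => sum_congr rfl fun j hj => ?_
    rw [mem_range] at hi hj
    rw [show q - 1 - (q - 1 - j) = j by omega]
  · intro i j
    simp only [mem_range]
    omega

theorem reflectPairing_letterOp (q : ℕ) [Fact (q + 1).Prime] (x : Bool)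
    (f g : ℕ → ZMod (q + 1)) :
    reflectPairing q (letterOp (q + 1) x f) g = -reflectPairing q f (letterOp (q + 1) x g) := by
  have key (F G : ℕ → ZMod (q + 1))
      (h : ∑ i ∈ range q, F i * g (q - 1 - i) = ∑ i ∈ range q, f i * G (q - 1 - i)) :
      reflectPairing q (fun i => ((i + 1 : ℕ) : ZMod (q + 1))⁻¹ * F i) g =
        -reflectPairing q f (fun i => ((i + 1 : ℕ) : ZMod (q + 1))⁻¹ * G i) := by
    unfold reflectPairing
    rw [← sum_neg_distrib]
    trans ∑ i ∈ range q, F i * g (q - 1 - i)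
    · refine sum_congr rfl fun i hi => ?_
      rw [mul_inv_cancel_left₀ (natCast_zmod_ne_zero (by simpa using hi))]
    · rw [h]
      refine sum_congr rfl fun i hi => ?_
      linear_combination (f i * G (q - 1 - i)) * natCast_mul_inv_reflect (mem_range.1 hi)
  cases x with
  | false => exact key f g rfl
  | true => exact key _ (fun i => ∑ j ∈ range (i + 1), g j) (sum_partialSum_mul_reflect q f g)

theorem reflectPairing_foldr (q : ℕ) [Fact (q + 1).Prime] (w : List Bool)
    (f g : ℕ → ZMod (q + 1)) :
    reflectPairing q (w.foldr (letterOp (q + 1)) f) g =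
      (-1) ^ w.length * reflectPairing q f (w.reverse.foldr (letterOp (q + 1)) g) := by
  induction w generalizing g with
  | nil => simp
  | cons x w ih =>
    rw [List.foldr_cons, reflectPairing_letterOp, ih, List.length_cons, List.reverse_cons,
      List.foldr_append, pow_succ]
    simp

/-- The reversal relation. -/
theorem sum_wordSeq_reverse (q : ℕ) [Fact (q + 1).Prime] (w : List Bool) :
    ∑ i ∈ range q, wordSeq (q + 1) w i =
      (-1) ^ (w.length + 1) * ∑ i ∈ range q, wordSeq (q + 1) w.reverse i := by
  have h1 (f : ℕ → ZMod (q + 1)) :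
      reflectPairing q f (fun i => ((i + 1 : ℕ) : ZMod (q + 1))⁻¹) = -∑ i ∈ range q, f i := by
    rw [reflectPairing, ← sum_neg_distrib]
    refine sum_congr rfl fun i hi => ?_
    linear_combination f i * natCast_mul_inv_reflect (mem_range.1 hi)
  have h2 (f : ℕ → ZMod (q + 1)) :
      reflectPairing q (fun i => ((i + 1 : ℕ) : ZMod (q + 1))⁻¹) f = ∑ i ∈ range q, f i := by
    rw [reflectPairing, ← sum_range_reflect f]
    refine sum_congr rfl fun i hi => ?_
    rw [mul_inv_cancel₀ (natCast_zmod_ne_zero (by simpa using hi)), one_mul]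
  have h := reflectPairing_foldr q w (fun i => ((i + 1 : ℕ) : ZMod (q + 1))⁻¹)
    (fun i => ((i + 1 : ℕ) : ZMod (q + 1))⁻¹)
  rw [h1, h2] at h
  rw [pow_succ]
  unfold wordSeq
  linear_combination -h

theorem foldr_replicate_false (p n i : ℕ) (f : ℕ → ZMod p) :
    (List.replicate n false).foldr (letterOp p) f i = (((i + 1 : ℕ) : ZMod p)⁻¹) ^ n * f i := by
  induction n with
  | zero => simp
  | succ n ih =>
    rw [List.replicate_succ, List.foldr_cons, letterOp, ih, pow_succ']
    ring

theorem mhsStar_cons_succ (p k : ℕ) (l : List ℕ) (n : ℕ) :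
    mhsStar p (k :: l) (n + 1) =
      ∑ i ∈ range n, (((i + 1 : ℕ) : ZMod p)⁻¹) ^ k * mhsStar p l (i + 1 + 1) := by
  rw [mhsStar]
  have h : Ioo 0 (n + 1) = (range n).map (addRightEmbedding 1) := by
    ext m
    simp only [mem_Ioo, mem_map, mem_range, addRightEmbedding_apply]
    exact ⟨fun h => ⟨m - 1, by omega, by omega⟩, by rintro ⟨i, hi, rfl⟩; omega⟩
  rw [h, sum_map]
  rfl

theorem mhsStar_eq_sum_wordSeq (p : ℕ) (l : List ℕ) (hl : l ≠ []) (hpos : ∀ k ∈ l, 0 < k)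
    (n : ℕ) : mhsStar p l (n + 1) = ∑ i ∈ range n, wordSeq p (indexWord l) i := by
  induction l generalizing n with
  | nil => exact absurd rfl hl
  | cons k l ih =>
    obtain ⟨k, rfl⟩ := Nat.exists_eq_succ_of_ne_zero (hpos k (by simp)).ne'
    rw [mhsStar_cons_succ]
    refine sum_congr rfl fun i _ => ?_
    cases l with
    | nil => simp [mhsStar, indexWord, wordSeq, foldr_replicate_false, pow_succ]
    | cons l ls =>
      rw [ih (by simp) (fun j hj => hpos j (List.mem_cons_of_mem _ hj)), indexWord]
      unfold wordSeq
      rw [List.foldr_append, foldr_replicate_false, List.foldr_cons, letterOp, Nat.succ_sub_one,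
        pow_succ, mul_assoc]

theorem indexWord_cons {l : List ℕ} (hl : l ≠ []) (k : ℕ) :
    indexWord (k :: l) = List.replicate (k - 1) false ++ true :: indexWord l := by
  cases l with
  | nil => exact absurd rfl hl
  | cons => rfl

theorem indexWord_replicate_append {l : List ℕ} (hl : l ≠ []) (n : ℕ) :
    indexWord (List.replicate n 1 ++ l) = List.replicate n true ++ indexWord l := by
  induction n with
  | zero => simp
  | succ n ih =>
    rw [List.replicate_succ, List.cons_append, indexWord_cons (by simp [hl]), ih]
    simp [List.replicate_succ]

theorem abIndex_cons_cons {as bs : List ℕ} (has : as ≠ []) (a b : ℕ) :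
    abIndex (a :: as) (b :: bs) = List.replicate (a - 1) 1 ++ (b + 1) :: abIndex as bs := by
  cases as with
  | nil => exact absurd rfl has
  | cons => simp [abIndex]

theorem abIndex_ne_nil {a b : List ℕ} (ha : a ≠ []) (hlen : a.length = b.length) :
    abIndex a b ≠ [] := by
  match a, b with
  | [], _ => exact absurd rfl ha
  | [x], [y] => simp [abIndex]
  | x :: z :: as, y :: bs => simp [abIndex]

theorem abIndex_pos {a b : List ℕ} (hb : ∀ i ∈ b, 0 < i) : ∀ k ∈ abIndex a b, 0 < k := by
  fun_induction abIndex a b with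
  | case1 a b =>
    intro k hk
    simp only [List.mem_append, List.mem_replicate, List.mem_singleton] at hk
    rcases hk with ⟨_, rfl⟩ | rfl
    · exact one_pos
    · exact hb _ (by simp)
  | case2 a as b bs _ ih =>
    intro k hk
    simp only [List.mem_append, List.mem_replicate, List.mem_singleton] at hk
    rcases hk with (⟨_, rfl⟩ | rfl) | hk
    · exact one_pos
    · exact Nat.succ_pos b
    · exact ih (fun i hi => hb i (List.mem_cons_of_mem _ hi)) k hk
  | case3 => simp

theorem cons_indexWord_abIndex {a b : List ℕ} (hne : a ≠ []) (hlen : a.length = b.length)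
    (ha : ∀ i ∈ a, 0 < i) (hb : ∀ i ∈ b, 0 < i) :
    true :: (indexWord (abIndex a b) ++ [false]) = abWord a b := by
  induction a generalizing b with
  | nil => exact absurd rfl hne
  | cons x as ih =>
    obtain _ | ⟨y, bs⟩ := b
    · simp at hlen
    obtain ⟨x, rfl⟩ := Nat.exists_eq_succ_of_ne_zero (ha x (by simp)).ne'
    by_cases has : as = []
    · subst has
      obtain rfl : bs = [] := by simpa using hlen.symm
      obtain ⟨y, rfl⟩ := Nat.exists_eq_succ_of_ne_zero (hb y (by simp)).ne'
      simp [abIndex, abWord, indexWord_replicate_append, indexWord, List.replicate_succ,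
        ← List.replicate_succ']
    · have hlen' : as.length = bs.length := by simpa using hlen
      have h := ih has hlen' (fun i hi => ha i (List.mem_cons_of_mem _ hi))
        (fun i hi => hb i (List.mem_cons_of_mem _ hi))
      rw [abIndex_cons_cons has, indexWord_replicate_append (by simp),
        indexWord_cons (abIndex_ne_nil has hlen')]
      simp only [abWord, List.zipWith_cons_cons, List.flatten_cons] at h ⊢
      rw [← h]
      simp [List.replicate_succ]

theorem abWord_reverse {a b : List ℕ} (hlen : a.length = b.length) :
    abWord b.reverse a.reverse = ((abWord a b).map (!·)).reverse := by
  unfold abWord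
  rw [List.map_flatten, List.reverse_flatten, ← List.reverse_zipWith hlen.symm,
    List.zipWith_comm, List.map_map, List.map_zipWith]
  simp

theorem length_abWord {a b : List ℕ} (hlen : a.length = b.length) :
    (abWord a b).length = a.sum + b.sum := by
  induction a generalizing b with
  | nil =>
    obtain rfl : b = [] := by simpa using hlen.symm
    rfl
  | cons x as ih =>
    obtain _ | ⟨y, bs⟩ := b
    · simp at hlen
    have h := ih (b := bs) (by simpa using hlen)
    simp only [abWord, List.zipWith_cons_cons, List.flatten_cons, List.length_append,
      List.length_replicate, List.sum_cons] at h ⊢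
    omega

/-- Hoffman's duality combined with reversal for finite multiple zeta star values: for
`k = [a_1,…,a_r;b_1,…,b_r]` and `k' = [b_r,…,b_1;a_r,…,a_1]`, for all sufficiently large
primes `p` one has, in `𝔽_p`,
`∑_{p>m_1≥⋯≥m_s>0} ∏_j m_j^{-k_j} = (-1)^{a_1+⋯+a_r+b_1+⋯+b_r}·∑_{p>m_1≥⋯≥m_{s'}>0} ∏_j m_j^{-k'_j}`. -/
theorem stmt_18 (a b : List ℕ) (ha : a ≠ []) (hlen : a.length = b.length)
    (hapos : ∀ i ∈ a, 0 < i) (hbpos : ∀ i ∈ b, 0 < i) :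
    ∃ N : ℕ, ∀ p : ℕ, p.Prime → N < p →
      mhsStar p (abIndex a b) p =
        (-1 : ZMod p) ^ (a.sum + b.sum) * mhsStar p (abIndex b.reverse a.reverse) p := by
  refine ⟨0, fun p hp _ => ?_⟩
  obtain ⟨q, rfl⟩ := Nat.exists_eq_succ_of_ne_zero hp.ne_zero
  have : Fact (q + 1).Prime := ⟨hp⟩
  have hne : b ≠ [] := by
    rintro rfl
    exact ha (by simpa using hlen)
  have hlen' : b.reverse.length = a.reverse.length := by simp [hlen]
  have hw := cons_indexWord_abIndex ha hlen hapos hbpos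
  have hw' := cons_indexWord_abIndex (a := b.reverse) (b := a.reverse) (by simpa using hne) hlen'
    (by simpa using hbpos) (by simpa using hapos)
  rw [abWord_reverse hlen, ← hw] at hw'
  have hrev : indexWord (abIndex b.reverse a.reverse) =
      ((indexWord (abIndex a b)).map (!·)).reverse := by simpa using hw'
  have hsum := length_abWord hlen
  rw [← hw] at hsum
  simp only [List.length_cons, List.length_append, List.length_nil] at hsum
  rw [mhsStar_eq_sum_wordSeq _ _ (abIndex_ne_nil ha hlen) (abIndex_pos hbpos),
    mhsStar_eq_sum_wordSeq _ _ (abIndex_ne_nil (by simpa using hne) hlen')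
      (abIndex_pos (by simpa using hapos)), hrev, ← hsum]
  have h1 := sum_wordSeq_map_not q (indexWord (abIndex a b))
  rw [sum_wordSeq_reverse, List.length_map] at h1
  linear_combination h1
end
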